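/- Let P, Q ⊆ ℝ² be full-dimensional bipartite convex polytopes with the same parameters: both admit vertex partitions as in the definition of bipartite with the same radii r1 ≤ r2 and the same edge length ℓ. Then there is a linear isometry T of ℝ² with T(P) = Q; in particular P and Q have the same number of vertices. -/

import Mathlib

open Set Pointwise

noncomputable section

/-- Euclidean space `ℝ^d`. -/
abbrev Euc (d : ℕ) := EuclideanSpace ℝ (Fin d)

/-- A convex polytope: the convex hull of a finite set of points. -/
def IsPolytope {d : ℕ} (P : Set (Euc d)) : Prop :=
  ∃ S : Finset (Euc d), P = convexHull ℝ (S : Set (Euc d))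

/-- `P` is full-dimensional: its affine span is all of `ℝ^d`. -/
def FullDim {d : ℕ} (P : Set (Euc d)) : Prop :=
  affineSpan ℝ P = ⊤

/-- `[v,w]` is an edge of `P`: an exposed face of `P` which is a segment with `v ≠ w`. -/
def IsEdge {d : ℕ} (P : Set (Euc d)) (v w : Euc d) : Prop :=
  v ≠ w ∧ IsExposed ℝ P (segment ℝ v w)

/-- `e` is an edge of `P`, as a set. -/
def IsEdgeSet {d : ℕ} (P e : Set (Euc d)) : Prop :=
  ∃ v w : Euc d, IsEdge P v w ∧ e = segment ℝ v w

/-- `T` is a symmetry of `P`: a linear isometry mapping `P` onto itself. -/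
def IsAut {d : ℕ} (P : Set (Euc d)) (T : Euc d ≃ₗᵢ[ℝ] Euc d) : Prop :=
  T '' P = P

/-- `P` is vertex-transitive: any vertex (extreme point) can be mapped onto any
other by a symmetry of `P`. -/
def VertexTransitive {d : ℕ} (P : Set (Euc d)) : Prop :=
  ∀ v ∈ Set.extremePoints ℝ P, ∀ w ∈ Set.extremePoints ℝ P,
    ∃ T : Euc d ≃ₗᵢ[ℝ] Euc d, IsAut P T ∧ T v = w

/-- `P` is edge-transitive: any edge can be mapped onto any other by a symmetry of `P`. -/
def EdgeTransitive {d : ℕ} (P : Set (Euc d)) : Prop :=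
  ∀ e e' : Set (Euc d), IsEdgeSet P e → IsEdgeSet P e' →
    ∃ T : Euc d ≃ₗᵢ[ℝ] Euc d, IsAut P T ∧ T '' e = e'

/-- `P` is bipartite with vertex partition `V1, V2`, radii `r1 ≤ r2` and edge length `ℓ`:
all edges have length `ℓ`, every edge joins `V1` to `V2`, where `V1 ⊔ V2` is a partition of
the vertex set, and vertices in `Vᵢ` have norm `rᵢ`. -/
def IsBipartiteWith {d : ℕ} (P V1 V2 : Set (Euc d)) (r1 r2 ℓ : ℝ) : Prop :=
  (0 < ℓ) ∧ (∀ v w : Euc d, IsEdge P v w → ‖v - w‖ = ℓ) ∧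
  (V1 ∪ V2 = Set.extremePoints ℝ P) ∧ Disjoint V1 V2 ∧
  (∀ v w : Euc d, IsEdge P v w → (v ∈ V1 ∧ w ∈ V2) ∨ (v ∈ V2 ∧ w ∈ V1)) ∧
  (0 < r1) ∧ (r1 ≤ r2) ∧ (∀ v ∈ V1, ‖v‖ = r1) ∧ (∀ v ∈ V2, ‖v‖ = r2)

/-- `P` is a bipartite polytope. -/
def IsBipartite {d : ℕ} (P : Set (Euc d)) : Prop :=
  ∃ (V1 V2 : Set (Euc d)) (r1 r2 ℓ : ℝ), IsBipartiteWith P V1 V2 r1 r2 ℓ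

/-- `P` is a strictly bipartite polytope (`r1 < r2`). -/
def IsStrictlyBipartite {d : ℕ} (P : Set (Euc d)) : Prop :=
  ∃ (V1 V2 : Set (Euc d)) (r1 r2 ℓ : ℝ), IsBipartiteWith P V1 V2 r1 r2 ℓ ∧ r1 < r2

/-! ### Edges at a vertex of a planar polytope -/

lemma IsPolytope.isCompact {d : ℕ} {P : Set (Euc d)} (hP : IsPolytope P) : IsCompact P := by
  obtain ⟨S, rfl⟩ := hP
  exact S.finite_toSet.isCompact_convexHull (𝕜 := ℝ)

lemma IsPolytope.convex {d : ℕ} {P : Set (Euc d)} (hP : IsPolytope P) : Convex ℝ P := by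
  obtain ⟨S, rfl⟩ := hP
  exact convex_convexHull ℝ _

lemma IsPolytope.finite_extremePoints {d : ℕ} {P : Set (Euc d)} (hP : IsPolytope P) :
    (Set.extremePoints ℝ P).Finite := by
  obtain ⟨S, rfl⟩ := hP
  exact S.finite_toSet.subset extremePoints_convexHull_subset

/-- A compact convex set with finitely many extreme points is their convex hull. -/
lemma convexHull_extremePoints_of_finite {d : ℕ} {P : Set (Euc d)} (hc : IsCompact P)
    (hconv : Convex ℝ P) (hfin : (Set.extremePoints ℝ P).Finite) :
    convexHull ℝ (Set.extremePoints ℝ P) = P := by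
  rw [← (hfin.isCompact_convexHull (𝕜 := ℝ)).isClosed.closure_eq]
  exact closure_convexHull_extremePoints hc hconv

/-- A vertex of a polytope is separated from all other vertices by a linear functional. -/
lemma IsPolytope.exists_lt_of_mem_extremePoints {d : ℕ} {P : Set (Euc d)} (hP : IsPolytope P)
    {v : Euc d} (hv : v ∈ Set.extremePoints ℝ P) :
    ∃ f : Euc d →L[ℝ] ℝ, ∀ x ∈ Set.extremePoints ℝ P, x ≠ v → f x < f v := by
  have hfin : (Set.extremePoints ℝ P \ {v}).Finite := hP.finite_extremePoints.subset sdiff_subset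
  have hnot : v ∉ convexHull ℝ (Set.extremePoints ℝ P \ {v}) := fun h =>
    (hP.convex.mem_extremePoints_iff_mem_sdiff_convexHull_sdiff.1 hv).2
      (convexHull_mono (sdiff_subset_sdiff_left extremePoints_subset) h)
  obtain ⟨f, u, hf, hu⟩ := geometric_hahn_banach_closed_point (convex_convexHull ℝ _)
    (hfin.isCompact_convexHull (𝕜 := ℝ)).isClosed hnot
  exact ⟨f, fun x hx hxv => (hf x (subset_convexHull ℝ _ ⟨hx, hxv⟩)).trans hu⟩

/-- Rotating a supporting line about the vertex `v`, in the direction given by `g`, until it meets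
another vertex yields an edge at `v`. -/
lemma IsPolytope.exists_isEdge {d : ℕ} {P : Set (Euc d)} (hP : IsPolytope P) {v : Euc d}
    (hv : v ∈ Set.extremePoints ℝ P) {f g : Euc d →L[ℝ] ℝ}
    (hf : ∀ x ∈ Set.extremePoints ℝ P, x ≠ v → f x < f v)
    (hfg : ∀ z, f z = 0 → g z = 0 → z = 0) (hne : ∃ x ∈ Set.extremePoints ℝ P, x ≠ v) :
    ∃ (w : Euc d) (m : ℝ), IsEdge P v w ∧ f w < f v ∧ g w - g v = m * (f v - f w) ∧
      ∀ x ∈ P, g x - g v ≤ m * (f v - f x) := by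
  obtain ⟨x₁, hx₁, hx₁v⟩ := hne
  have hhull := convexHull_extremePoints_of_finite hP.isCompact hP.convex hP.finite_extremePoints
  have hNfin : (Set.extremePoints ℝ P \ {v}).Finite := hP.finite_extremePoints.subset sdiff_subset
  obtain ⟨x₀, hx₀, hmax⟩ := Set.exists_max_image _ (fun x => (g x - g v) / (f v - f x)) hNfin
    ⟨x₁, hx₁, hx₁v⟩
  obtain ⟨m, hm⟩ : ∃ m, m = (g x₀ - g v) / (f v - f x₀) := ⟨_, rfl⟩
  have hslope : ∀ x ∈ Set.extremePoints ℝ P, g x - g v ≤ m * (f v - f x) := by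
    intro x hx
    by_cases hxv : x = v
    · simp [hxv]
    · have h := hmax x ⟨hx, hxv⟩
      rw [← hm] at h
      exact (div_le_iff₀ (sub_pos.2 (hf x hx hxv))).1 h
  have hx₀m : g x₀ - g v = m * (f v - f x₀) := by
    rw [hm, div_mul_cancel₀ _ (sub_pos.2 (hf x₀ hx₀.1 hx₀.2)).ne']
  obtain ⟨w, ⟨hw, hwm⟩, hmin⟩ := Set.exists_min_image
    {x ∈ Set.extremePoints ℝ P \ {v} | g x - g v = m * (f v - f x)} f
    (hNfin.subset (sep_subset _ _)) ⟨x₀, hx₀, hx₀m⟩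
  have hfw := hf w hw.1 hw.2
  set h : Euc d →L[ℝ] ℝ := g + m • f with hh
  have hh_apply : ∀ x, h x = g x + m * f x := fun x => by simp [hh]
  have hle : ∀ x ∈ P, h x ≤ h v := by
    intro x hx
    rw [← hhull] at hx
    refine convexHull_min (t := {y | h y ≤ h v}) (fun y hy => ?_)
      (convex_halfSpace_le h.toLinearMap.isLinear _) hx
    have := hslope y hy
    simp only [mem_ofPred_eq, hh_apply]
    linarith
  have hwv : h w = h v := by
    simp only [hh_apply]
    linarith
  have hexp : IsExposed ℝ P {x ∈ P | ∀ y ∈ P, h y ≤ h x} := fun _ => ⟨h, rfl⟩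
  have hface : {x ∈ P | ∀ y ∈ P, h y ≤ h x} = segment ℝ v w := by
    apply Subset.antisymm
    · have hext := hexp.isExtreme.extremePoints_eq
      have hcomp := hexp.isCompact hP.isCompact
      have hcon := hexp.convex hP.convex
      rw [← convexHull_extremePoints_of_finite hcomp hcon
        (hP.finite_extremePoints.subset (hext ▸ inter_subset_right))]
      refine convexHull_min ?_ (convex_segment v w)
      intro x hx
      rw [hext] at hx
      by_cases hxv : x = v
      · rw [hxv]; exact left_mem_segment ℝ v w
      have hxh : h x = h v := le_antisymm (hle x hx.1.1) (hx.1.2 v hv.1)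
      have hxm : g x - g v = m * (f v - f x) := by
        simp only [hh_apply] at hxh
        linarith
      have hwx := hmin x ⟨⟨hx.2, hxv⟩, hxm⟩
      have hfx := hf x hx.2 hxv
      have hpos : 0 < f v - f w := sub_pos.2 hfw
      obtain ⟨τ, hτ⟩ : ∃ τ, τ = (f v - f x) / (f v - f w) := ⟨_, rfl⟩
      have hτm : τ * (f v - f w) = f v - f x := by rw [hτ, div_mul_cancel₀ _ hpos.ne']
      have hzero : x - (v + τ • (w - v)) = 0 := by
        apply hfg
        · simp only [map_sub, map_add, map_smul, smul_eq_mul]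
          linarith
        · simp only [map_sub, map_add, map_smul, smul_eq_mul]
          linear_combination hxm - τ * hwm - m * hτm
      rw [segment_eq_image']
      refine ⟨τ, ⟨?_, ?_⟩, (sub_eq_zero.1 hzero).symm⟩
      · rw [hτ]; exact div_nonneg (by linarith) hpos.le
      · rw [hτ, div_le_one hpos]; linarith
    · exact (hexp.convex hP.convex).segment_subset ⟨hv.1, hle⟩
        ⟨hw.1.1, fun y hy => (hle y hy).trans_eq hwv.symm⟩
  refine ⟨w, m, ⟨fun h => hw.2 h.symm, hface ▸ hexp⟩, hfw, hwm, fun x hx => ?_⟩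
  have := hle x hx
  simp only [hh_apply] at this
  linarith

/-- Every vertex of a full-dimensional polygon lies on two edges. -/
lemma IsPolytope.exists_two_isEdge {P : Set (Euc 2)} (hP : IsPolytope P) (hfull : FullDim P)
    {v : Euc 2} (hv : v ∈ Set.extremePoints ℝ P) :
    ∃ w w' : Euc 2, w ≠ w' ∧ IsEdge P v w ∧ IsEdge P v w' := by
  have hhull := convexHull_extremePoints_of_finite hP.isCompact hP.convex hP.finite_extremePoints
  have hline : ∀ l : Euc 2 →L[ℝ] ℝ, (∀ x ∈ P, l x = l v) → l = 0 := by
    intro l hl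
    ext z
    have hsub : affineSpan ℝ P ≤ AffineSubspace.mk' v (LinearMap.ker l.toLinearMap) := by
      refine affineSpan_le.2 fun x hx => ?_
      simp [hl x hx]
    have hz : z + v ∈ AffineSubspace.mk' v (LinearMap.ker l.toLinearMap) :=
      hsub (by rw [hfull]; trivial)
    simpa using hz
  have hne : ∃ x ∈ Set.extremePoints ℝ P, x ≠ v := by
    by_contra! hcon
    have hPv : ∀ x ∈ P, x = v := by
      intro x hx
      rw [← hhull] at hx
      exact convexHull_min (t := {v}) hcon (convex_singleton v) hx
    have h0 := hline (EuclideanSpace.proj 0) fun x hx => by rw [hPv x hx]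
    have := DFunLike.congr_fun h0 (EuclideanSpace.single 0 1)
    simp at this
  obtain ⟨f, hf⟩ := hP.exists_lt_of_mem_extremePoints hv
  obtain ⟨x₁, hx₁, hx₁v⟩ := hne
  have hf_apply : ∀ z : Euc 2, f z =
      f (EuclideanSpace.single 0 1) * z 0 + f (EuclideanSpace.single 1 1) * z 1 := by
    intro z
    have hz : z = z 0 • EuclideanSpace.single 0 1 + z 1 • EuclideanSpace.single 1 1 := by
      ext i; fin_cases i <;> simp
    conv_lhs => rw [hz]
    simp only [map_add, map_smul, smul_eq_mul]
    ring
  obtain ⟨a, ha⟩ : ∃ a, a = f (EuclideanSpace.single 0 1) := ⟨_, rfl⟩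
  obtain ⟨b, hb⟩ : ∃ b, b = f (EuclideanSpace.single 1 1) := ⟨_, rfl⟩
  rw [← ha, ← hb] at hf_apply
  set g : Euc 2 →L[ℝ] ℝ := a • EuclideanSpace.proj 1 - b • EuclideanSpace.proj 0 with hg
  have hg_apply : ∀ z, g z = a * z 1 - b * z 0 := fun z => by simp [hg]
  have hab : a ^ 2 + b ^ 2 ≠ 0 := by
    intro h
    have ha0 : a = 0 := by nlinarith
    have hb0 : b = 0 := by nlinarith
    have := hf x₁ hx₁ hx₁v
    simp [hf_apply, ha0, hb0] at this
  have hfg : ∀ z, f z = 0 → g z = 0 → z = 0 := by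
    intro z h1 h2
    rw [hf_apply] at h1
    rw [hg_apply] at h2
    ext i
    fin_cases i
    · refine (mul_eq_zero.1 (?_ : (a ^ 2 + b ^ 2) * z 0 = 0)).resolve_left hab
      linear_combination a * h1 - b * h2
    · refine (mul_eq_zero.1 (?_ : (a ^ 2 + b ^ 2) * z 1 = 0)).resolve_left hab
      linear_combination b * h1 + a * h2
  obtain ⟨w, m, hw, hfw, hgw, hwP⟩ := hP.exists_isEdge hv hf hfg ⟨x₁, hx₁, hx₁v⟩
  obtain ⟨w', m', hw', hfw', hgw', hwP'⟩ := hP.exists_isEdge hv (g := -g) hf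
    (fun z h1 h2 => hfg z h1 (by simpa using h2)) ⟨x₁, hx₁, hx₁v⟩
  refine ⟨w, w', ?_, hw, hw'⟩
  rintro rfl
  simp only [neg_apply] at hgw' hwP'
  have hmm : m' = -m := by
    refine mul_right_cancel₀ (sub_pos.2 hfw).ne' ?_
    linarith
  subst hmm
  have hzero := hline (g + m • f) fun x hx => by
    have h1 := hwP x hx
    have h2 := hwP' x hx
    simp only [add_apply, smul_apply, smul_eq_mul]
    linarith
  have e0 := DFunLike.congr_fun hzero (EuclideanSpace.single 0 1)
  have e1 := DFunLike.congr_fun hzero (EuclideanSpace.single 1 1)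
  simp [hg_apply, hf_apply] at e0 e1
  apply hab
  linear_combination a * e1 - b * e0

/-! ### Polar coordinates -/

/-- The point of the plane with polar coordinates `(r, φ)`. -/
def polarPoint (r φ : ℝ) : Euc 2 := !₂[r * Real.cos φ, r * Real.sin φ]

@[simp] lemma polarPoint_zero (r φ : ℝ) : polarPoint r φ 0 = r * Real.cos φ := rfl

@[simp] lemma polarPoint_one (r φ : ℝ) : polarPoint r φ 1 = r * Real.sin φ := rfl

lemma exists_eq_polarPoint (x : Euc 2) : ∃ φ, x = polarPoint ‖x‖ φ := by
  have hn : ‖(⟨x 0, x 1⟩ : ℂ)‖ = ‖x‖ := by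
    rw [EuclideanSpace.norm_eq, Complex.norm_eq_sqrt_sq_add_sq]
    simp
  refine ⟨Complex.arg ⟨x 0, x 1⟩, ?_⟩
  ext i
  fin_cases i
  · simp [← hn, Complex.norm_mul_cos_arg]
  · simp [← hn, Complex.norm_mul_sin_arg]

lemma polarPoint_add_int_mul_two_pi (r φ : ℝ) (k : ℤ) :
    polarPoint r (φ + k * (2 * Real.pi)) = polarPoint r φ := by
  simp [polarPoint]

lemma norm_polarPoint_sub_sq (r s φ ψ : ℝ) :
    ‖polarPoint r φ - polarPoint s ψ‖ ^ 2 = r ^ 2 + s ^ 2 - 2 * r * s * Real.cos (ψ - φ) := by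
  rw [EuclideanSpace.norm_sq_eq, Real.cos_sub]
  simp only [Fin.sum_univ_two, PiLp.sub_apply, polarPoint_zero, polarPoint_one, Real.norm_eq_abs,
    sq_abs]
  linear_combination r ^ 2 * Real.sin_sq_add_cos_sq φ + s ^ 2 * Real.sin_sq_add_cos_sq ψ

/-- The point with angle `φ + α` in the basis given by the angles `φ` and `φ + θ`. -/
lemma polarPoint_add_eq {r s θ : ℝ} (hr : r ≠ 0) (hs : s ≠ 0) (hθ : Real.sin θ ≠ 0) (t φ α : ℝ) :
    polarPoint t (φ + α) = (t * Real.sin (θ - α) / (r * Real.sin θ)) • polarPoint r φ +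
      (t * Real.sin α / (s * Real.sin θ)) • polarPoint s (φ + θ) := by
  ext i
  fin_cases i
  · simp [Real.cos_add, Real.sin_sub]
    field_simp
    ring
  · simp [Real.sin_add, Real.sin_sub]
    field_simp
    ring

/-- Rotation of the plane by the angle `δ`. -/
def planeRotation (δ : ℝ) : Euc 2 ≃ₗᵢ[ℝ] Euc 2 :=
  (Complex.orthonormalBasisOneI.repr.symm.trans (rotation (Circle.exp δ))).trans
    Complex.orthonormalBasisOneI.repr

lemma planeRotation_polarPoint (δ r φ : ℝ) :
    planeRotation δ (polarPoint r φ) = polarPoint r (φ + δ) := by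
  ext i
  fin_cases i
  · simp [planeRotation, Complex.exp_re, Complex.exp_im, Real.cos_add,
      -Complex.ofReal_mul, -Complex.ofReal_cos, -Complex.ofReal_sin]
    ring
  · simp [planeRotation, Complex.exp_re, Complex.exp_im, Real.sin_add,
      -Complex.ofReal_mul, -Complex.ofReal_cos, -Complex.ofReal_sin]
    ring

/-! ### The vertices of a bipartite polygon -/

/-- The version of `IsBipartiteWith` which is symmetric in the two vertex classes. -/
structure HasBipartition (P A B : Set (Euc 2)) (r s ℓ : ℝ) : Prop where
  norm_edge : ∀ v w, IsEdge P v w → ‖v - w‖ = ℓ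
  union_eq : A ∪ B = Set.extremePoints ℝ P
  disjoint : Disjoint A B
  edge_mem : ∀ v w, IsEdge P v w → (v ∈ A ∧ w ∈ B) ∨ (v ∈ B ∧ w ∈ A)
  left_pos : 0 < r
  right_pos : 0 < s
  norm_left : ∀ v ∈ A, ‖v‖ = r
  norm_right : ∀ v ∈ B, ‖v‖ = s

lemma IsBipartiteWith.hasBipartition {P A B : Set (Euc 2)} {r s ℓ : ℝ}
    (h : IsBipartiteWith P A B r s ℓ) : HasBipartition P A B r s ℓ := by
  obtain ⟨-, h1, h2, h3, h4, h5, h6, h7, h8⟩ := h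
  exact ⟨h1, h2, h3, h4, h5, h5.trans_le h6, h7, h8⟩

/-- The angle at the origin of a triangle with sides `r`, `s` at the origin and opposite
side `ℓ`. -/
def edgeAngle (r s ℓ : ℝ) : ℝ := Real.arccos ((r ^ 2 + s ^ 2 - ℓ ^ 2) / (2 * r * s))

lemma edgeAngle_comm (r s ℓ : ℝ) : edgeAngle r s ℓ = edgeAngle s r ℓ := by
  unfold edgeAngle
  congr 1
  ring

namespace HasBipartition

variable {P A B : Set (Euc 2)} {r s ℓ : ℝ}

protected lemma symm (h : HasBipartition P A B r s ℓ) : HasBipartition P B A s r ℓ where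
  norm_edge := h.norm_edge
  union_eq := by rw [union_comm, h.union_eq]
  disjoint := h.disjoint.symm
  edge_mem v w hvw := (h.edge_mem v w hvw).symm
  left_pos := h.right_pos
  right_pos := h.left_pos
  norm_left := h.norm_right
  norm_right := h.norm_left

lemma left_subset (h : HasBipartition P A B r s ℓ) : A ⊆ Set.extremePoints ℝ P :=
  h.union_eq ▸ subset_union_left

lemma mem_right (h : HasBipartition P A B r s ℓ) {v w : Euc 2} (hv : v ∈ A)
    (hvw : IsEdge P v w) : w ∈ B := by
  rcases h.edge_mem v w hvw with h' | h'
  · exact h'.2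
  · exact (disjoint_left.1 h.disjoint hv h'.1).elim

lemma eq_polarPoint_of_isEdge (h : HasBipartition P A B r s ℓ) {φ : ℝ} {w : Euc 2}
    (hv : polarPoint r φ ∈ A) (hw : IsEdge P (polarPoint r φ) w) :
    w = polarPoint s (φ + edgeAngle r s ℓ) ∨ w = polarPoint s (φ - edgeAngle r s ℓ) := by
  obtain ⟨ψ, hψ⟩ := exists_eq_polarPoint w
  rw [h.norm_right w (h.mem_right hv hw)] at hψ
  subst hψ
  have hlen := norm_polarPoint_sub_sq r s φ ψ
  rw [h.norm_edge _ _ hw] at hlen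
  have hr := h.left_pos.ne'
  have hs := h.right_pos.ne'
  have hcos : Real.cos (edgeAngle r s ℓ) = Real.cos (ψ - φ) := by
    have : (r ^ 2 + s ^ 2 - ℓ ^ 2) / (2 * r * s) = Real.cos (ψ - φ) := by
      rw [hlen]
      field_simp
      ring
    rw [edgeAngle, this, Real.cos_arccos (Real.neg_one_le_cos _) (Real.cos_le_one _)]
  obtain ⟨k, hk | hk⟩ := Real.cos_eq_cos_iff.1 hcos
  · left
    rw [← polarPoint_add_int_mul_two_pi s (φ + edgeAngle r s ℓ) k]
    congr 1
    linarith
  · right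
    rw [← polarPoint_add_int_mul_two_pi s (φ - edgeAngle r s ℓ) k]
    congr 1
    linarith

lemma isEdge_add_sub (h : HasBipartition P A B r s ℓ) (hP : IsPolytope P)
    (hfull : FullDim P) {φ : ℝ} (hv : polarPoint r φ ∈ A) :
    IsEdge P (polarPoint r φ) (polarPoint s (φ + edgeAngle r s ℓ)) ∧
    IsEdge P (polarPoint r φ) (polarPoint s (φ - edgeAngle r s ℓ)) ∧
    polarPoint s (φ + edgeAngle r s ℓ) ≠ polarPoint s (φ - edgeAngle r s ℓ) := by
  obtain ⟨w, w', hne, hw, hw'⟩ := hP.exists_two_isEdge hfull (h.left_subset hv)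
  rcases h.eq_polarPoint_of_isEdge hv hw with rfl | rfl <;>
  rcases h.eq_polarPoint_of_isEdge hv hw' with rfl | rfl
  · exact (hne rfl).elim
  · exact ⟨hw, hw', hne⟩
  · exact ⟨hw', hw, hne.symm⟩
  · exact (hne rfl).elim

lemma sin_edgeAngle_pos (h : HasBipartition P A B r s ℓ) (hP : IsPolytope P)
    (hfull : FullDim P) (hA : A.Nonempty) : 0 < Real.sin (edgeAngle r s ℓ) := by
  obtain ⟨v, hv⟩ := hA
  obtain ⟨φ, hφ⟩ := exists_eq_polarPoint v
  rw [h.norm_left v hv] at hφ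
  subst hφ
  refine lt_of_le_of_ne
    (Real.sin_nonneg_of_nonneg_of_le_pi (Real.arccos_nonneg _) (Real.arccos_le_pi _)) fun h0 => ?_
  refine (h.isEdge_add_sub hP hfull hv).2.2 ?_
  simp [polarPoint, Real.cos_add, Real.cos_sub, Real.sin_add, Real.sin_sub, ← h0]

lemma add_mem_right (h : HasBipartition P A B r s ℓ) (hP : IsPolytope P) (hfull : FullDim P)
    {φ : ℝ} (hv : polarPoint r φ ∈ A) : polarPoint s (φ + edgeAngle r s ℓ) ∈ B :=
  h.mem_right hv (h.isEdge_add_sub hP hfull hv).1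

lemma sub_mem_right (h : HasBipartition P A B r s ℓ) (hP : IsPolytope P) (hfull : FullDim P)
    {φ : ℝ} (hv : polarPoint r φ ∈ A) : polarPoint s (φ - edgeAngle r s ℓ) ∈ B :=
  h.mem_right hv (h.isEdge_add_sub hP hfull hv).2.1

lemma right_nonempty (h : HasBipartition P A B r s ℓ) (hP : IsPolytope P) (hfull : FullDim P)
    (hA : A.Nonempty) : B.Nonempty := by
  obtain ⟨v, hv⟩ := hA
  obtain ⟨w, -, -, hw, -⟩ := hP.exists_two_isEdge hfull (h.left_subset hv)
  exact ⟨w, h.mem_right hv hw⟩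

/-- The origin belongs to the polygon. -/
lemma zero_mem (h : HasBipartition P A B r s ℓ) (hP : IsPolytope P) (hfull : FullDim P)
    (hA : A.Nonempty) : (0 : Euc 2) ∈ P := by
  by_contra hnot
  have hsin := h.sin_edgeAngle_pos hP hfull hA
  obtain ⟨g, u, hg0, hgP⟩ := geometric_hahn_banach_point_closed hP.convex
    hP.isCompact.isClosed hnot
  rw [map_zero] at hg0
  obtain ⟨v, hv, hmin⟩ := Set.exists_min_image A g
    (hP.finite_extremePoints.subset h.left_subset) hA
  obtain ⟨φ, hφ⟩ := exists_eq_polarPoint v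
  rw [h.norm_left v hv] at hφ
  subst hφ
  have hadd := h.symm.add_mem_right hP hfull (h.add_mem_right hP hfull hv)
  have hsub := h.symm.sub_mem_right hP hfull (h.sub_mem_right hP hfull hv)
  rw [edgeAngle_comm s r] at hadd hsub
  set θ := edgeAngle r s ℓ with hθ
  have hsum : polarPoint r (φ + θ + θ) =
      (2 * Real.cos (2 * θ)) • polarPoint r φ - polarPoint r (φ - θ - θ) := by
    rw [add_assoc, sub_sub, ← two_mul]
    ext i
    fin_cases i
    · simp [Real.cos_add φ, Real.cos_sub]
      ring
    · simp [Real.sin_add φ, Real.sin_sub]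
      ring
  have h1 := hmin _ hadd
  have h2 := hmin _ hsub
  have h3 := hgP _ (h.left_subset hv).1
  rw [hsum, map_sub, map_smul, smul_eq_mul, Real.cos_two_mul, Real.cos_sq'] at h1
  nlinarith [mul_pos (hg0.trans h3) (mul_pos hsin hsin)]

/-- A functional exposing an edge is positive on it: the origin lies on the inner side. -/
lemma pos_of_exposes (h : HasBipartition P A B r s ℓ) (hP : IsPolytope P)
    (hfull : FullDim P) {φ : ℝ} (hv : polarPoint r φ ∈ A) {f : Euc 2 →L[ℝ] ℝ}
    (hf : segment ℝ (polarPoint r φ) (polarPoint s (φ + edgeAngle r s ℓ)) =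
      {x ∈ P | ∀ y ∈ P, f y ≤ f x}) : 0 < f (polarPoint r φ) := by
  set θ := edgeAngle r s ℓ with hθ
  have hr := h.left_pos.ne'
  have hw' : polarPoint s (φ - θ) ∈ B := h.sub_mem_right hP hfull hv
  have hfv := hf ▸ left_mem_segment ℝ (polarPoint r φ) (polarPoint s (φ + θ))
  have hfw := hf ▸ right_mem_segment ℝ (polarPoint r φ) (polarPoint s (φ + θ))
  have hw'P := (h.symm.left_subset hw').1
  have hvw : f (polarPoint s (φ + θ)) = f (polarPoint r φ) :=
    le_antisymm (hfv.2 _ hfw.1) (hfw.2 _ hfv.1)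
  have hw'_eq : polarPoint s (φ - θ) =
      (2 * Real.cos θ * s / r) • polarPoint r φ - polarPoint s (φ + θ) := by
    ext i
    fin_cases i
    · simp [Real.cos_add, Real.cos_sub]
      field_simp
      ring
    · simp [Real.sin_add, Real.sin_sub]
      field_simp
      ring
  have hnonneg : 0 ≤ f (polarPoint r φ) := by
    simpa using hfv.2 _ (h.zero_mem hP hfull ⟨_, hv⟩)
  refine lt_of_le_of_ne hnonneg fun h0 => ?_
  have hmem : polarPoint s (φ - θ) ∈ segment ℝ (polarPoint r φ) (polarPoint s (φ + θ)) := by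
    rw [hf]
    refine ⟨hw'P, fun y hy => (hfv.2 y hy).trans ?_⟩
    rw [hw'_eq, map_sub, map_smul, hvw, ← h0]
    simp
  rcases (mem_extremePoints_iff_forall_segment.1 (h.symm.left_subset hw')).2 _ hfv.1 _ hfw.1 hmem
    with heq | heq
  · exact disjoint_left.1 h.disjoint hv (heq ▸ hw')
  · exact (h.isEdge_add_sub hP hfull hv).2.2 heq

/-- The only vertices in the cone spanned by an edge are the endpoints of the edge. -/
lemma eq_or_eq_of_mem_cone (h : HasBipartition P A B r s ℓ) (hP : IsPolytope P)
    (hfull : FullDim P) {φ t α : ℝ} (hv : polarPoint r φ ∈ A) (ht : 0 < t)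
    (hx : polarPoint t (φ + α) ∈ Set.extremePoints ℝ P) (hα : 0 ≤ α)
    (hαθ : α ≤ edgeAngle r s ℓ) :
    polarPoint t (φ + α) = polarPoint r φ ∨
      polarPoint t (φ + α) = polarPoint s (φ + edgeAngle r s ℓ) := by
  set θ := edgeAngle r s ℓ with hθ
  have hr := h.left_pos
  have hs := h.right_pos
  have hsin : 0 < Real.sin θ := h.sin_edgeAngle_pos hP hfull ⟨_, hv⟩
  have hθπ : θ ≤ Real.pi := Real.arccos_le_pi _
  obtain ⟨f, hf⟩ := (h.isEdge_add_sub hP hfull hv).1.2 ⟨_, left_mem_segment ℝ _ _⟩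
  have hfpos := h.pos_of_exposes hP hfull hv hf
  have hfv := hf ▸ left_mem_segment ℝ (polarPoint r φ) (polarPoint s (φ + θ))
  have hfw := hf ▸ right_mem_segment ℝ (polarPoint r φ) (polarPoint s (φ + θ))
  have hvw : f (polarPoint s (φ + θ)) = f (polarPoint r φ) :=
    le_antisymm (hfv.2 _ hfw.1) (hfw.2 _ hfv.1)
  have hxeq := polarPoint_add_eq hr.ne' hs.ne' hsin.ne' t φ α
  have hp : 0 ≤ t * Real.sin (θ - α) / (r * Real.sin θ) :=
    div_nonneg (mul_nonneg ht.le (Real.sin_nonneg_of_nonneg_of_le_pi (by linarith) (by linarith)))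
      (mul_pos hr hsin).le
  have hq : 0 ≤ t * Real.sin α / (s * Real.sin θ) :=
    div_nonneg (mul_nonneg ht.le (Real.sin_nonneg_of_nonneg_of_le_pi hα (by linarith)))
      (mul_pos hs hsin).le
  generalize t * Real.sin (θ - α) / (r * Real.sin θ) = p at hxeq hp
  generalize t * Real.sin α / (s * Real.sin θ) = q at hxeq hq
  have hx0 : polarPoint t (φ + α) ≠ 0 := by
    intro h0
    have h1 := congrArg (· 0) h0
    have h2 := congrArg (· 1) h0
    simp only [polarPoint_zero, polarPoint_one, PiLp.zero_apply, mul_eq_zero, ht.ne',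
      false_or] at h1 h2
    have h3 := Real.sin_sq_add_cos_sq (φ + α)
    simp [h1, h2] at h3
  rw [hxeq] at hx hx0 ⊢
  have hsum : p + q ≤ 1 := by
    have := hfv.2 _ hx.1
    rw [map_add, map_smul, map_smul, hvw, smul_eq_mul, smul_eq_mul] at this
    nlinarith
  have hσ : 0 < p + q := by
    refine lt_of_le_of_ne (add_nonneg hp hq) fun h0 => hx0 ?_
    have hp0 : p = 0 := by linarith
    have hq0 : q = 0 := by linarith
    simp [hp0, hq0]
  have hy : (p / (p + q)) • polarPoint r φ + (q / (p + q)) • polarPoint s (φ + θ) ∈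
      segment ℝ (polarPoint r φ) (polarPoint s (φ + θ)) :=
    ⟨_, _, div_nonneg hp hσ.le, div_nonneg hq hσ.le, by field_simp, rfl⟩
  have hyP := hP.convex.segment_subset hfv.1 hfw.1 hy
  have hxy : p • polarPoint r φ + q • polarPoint s (φ + θ) ∈ segment ℝ (0 : Euc 2)
      ((p / (p + q)) • polarPoint r φ + (q / (p + q)) • polarPoint s (φ + θ)) := by
    refine ⟨1 - (p + q), p + q, by linarith, hσ.le, by ring, ?_⟩
    rw [smul_zero, zero_add, smul_add, smul_smul, smul_smul, mul_div_cancel₀ _ hσ.ne',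
      mul_div_cancel₀ _ hσ.ne']
  have hext := (mem_extremePoints_iff_forall_segment.1 hx).2
  rcases hext _ (h.zero_mem hP hfull ⟨_, hv⟩) _ hyP hxy with heq | heq
  · exact (hx0 heq.symm).elim
  · rw [heq] at hy
    exact (hext _ hfv.1 _ hfw.1 hy).imp Eq.symm Eq.symm

lemma polarPoint_orbit_mem (h : HasBipartition P A B r s ℓ) (hP : IsPolytope P)
    (hfull : FullDim P) {φ : ℝ} (hv : polarPoint r φ ∈ A) (j : ℤ) :
    polarPoint r (φ + 2 * j * edgeAngle r s ℓ) ∈ A := by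
  induction j with
  | zero => simpa using hv
  | succ j ih =>
    have := h.symm.add_mem_right hP hfull (h.add_mem_right hP hfull ih)
    rw [edgeAngle_comm s r] at this
    convert this using 2
    push_cast
    ring
  | pred j ih =>
    have := h.symm.sub_mem_right hP hfull (h.sub_mem_right hP hfull ih)
    rw [edgeAngle_comm s r] at this
    convert this using 2
    push_cast
    ring

/-- The vertices of a bipartite polygon are the points obtained from one of them by walking
around the origin in steps of `edgeAngle r s ℓ`. -/
lemma extremePoints_eq (h : HasBipartition P A B r s ℓ) (hP : IsPolytope P)
    (hfull : FullDim P) {φ : ℝ} (hv : polarPoint r φ ∈ A) :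
    Set.extremePoints ℝ P =
      ⋃ j : ℤ, {polarPoint r (φ + 2 * j * edgeAngle r s ℓ),
        polarPoint s (φ + 2 * j * edgeAngle r s ℓ + edgeAngle r s ℓ)} := by
  have hsin := h.sin_edgeAngle_pos hP hfull ⟨_, hv⟩
  have horbit := h.polarPoint_orbit_mem hP hfull hv
  have hθ : 0 < edgeAngle r s ℓ := by
    refine lt_of_le_of_ne (Real.arccos_nonneg _) fun h0 => ?_
    simp [← h0] at hsin
  apply Subset.antisymm
  · intro x hx
    have ht : 0 < ‖x‖ := by
      rcases h.union_eq ▸ hx with hxA | hxB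
      · exact (h.norm_left x hxA).symm ▸ h.left_pos
      · exact (h.norm_right x hxB).symm ▸ h.right_pos
    obtain ⟨ψ, hψ⟩ := exists_eq_polarPoint x
    generalize ‖x‖ = t at ht hψ
    subst hψ
    set θ := edgeAngle r s ℓ with hθdef
    obtain ⟨k, hk⟩ : ∃ k : ℤ, k = ⌊(ψ - φ) / θ⌋ := ⟨_, rfl⟩
    have hk1 : k * θ ≤ ψ - φ := by
      rw [← le_div_iff₀ hθ, hk]; exact Int.floor_le _
    have hk2 : ψ - φ < (k + 1) * θ := by
      rw [← div_lt_iff₀ hθ, hk]; exact Int.lt_floor_add_one _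
    rcases Int.even_or_odd' k with ⟨j, hj | hj⟩
    · rw [hj] at hk1 hk2
      push_cast at hk1 hk2
      have e : ψ = φ + 2 * j * θ + (ψ - φ - 2 * j * θ) := by ring
      rw [e] at hx ⊢
      exact mem_iUnion.2 ⟨j, h.eq_or_eq_of_mem_cone hP hfull (horbit j) ht hx (by linarith)
        (by linarith)⟩
    · rw [hj] at hk1 hk2
      push_cast at hk1 hk2
      have e : ψ = φ + 2 * j * θ + θ + (ψ - φ - (2 * j + 1) * θ) := by ring
      rw [e] at hx ⊢
      have hcone := h.symm.eq_or_eq_of_mem_cone hP hfull (h.add_mem_right hP hfull (horbit j)) ht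
        hx (by linarith) (by rw [edgeAngle_comm s r]; linarith)
      rw [edgeAngle_comm s r] at hcone
      rcases hcone with hc | hc
      · exact mem_iUnion.2 ⟨j, Or.inr hc⟩
      · refine mem_iUnion.2 ⟨j + 1, Or.inl (hc.trans ?_)⟩
        congr 1
        push_cast
        ring
  · refine iUnion_subset fun j => ?_
    rintro x (rfl | rfl)
    · exact h.left_subset (horbit j)
    · exact h.symm.left_subset (h.add_mem_right hP hfull (horbit j))

lemma exists_polarPoint_mem_left (h : HasBipartition P A B r s ℓ) (hP : IsPolytope P)
    (hfull : FullDim P) : ∃ φ, polarPoint r φ ∈ A := by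
  have hPne : P.Nonempty := by
    by_contra! hcon
    have := hfull
    simp [FullDim, hcon] at this
  have hA : A.Nonempty := by
    obtain ⟨v, hv⟩ := hP.isCompact.extremePoints_nonempty hPne
    rcases h.union_eq ▸ hv with hvA | hvB
    · exact ⟨v, hvA⟩
    · exact h.symm.right_nonempty hP hfull ⟨v, hvB⟩
  obtain ⟨v, hv⟩ := hA
  obtain ⟨φ, hφ⟩ := exists_eq_polarPoint v
  rw [h.norm_left v hv] at hφ
  exact ⟨φ, hφ ▸ hv⟩

end HasBipartition

/-- Two full-dimensional bipartite polygons in `ℝ²` with the same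
parameters `r1 ≤ r2`, `ℓ` are related by a linear isometry; in particular they have the
same number of vertices. -/
theorem bipartite_polygon_determined_by_parameters
    (P Q V1 V2 W1 W2 : Set (Euc 2)) (r1 r2 ℓ : ℝ)
    (hP : IsPolytope P) (hPfull : FullDim P)
    (hQ : IsPolytope Q) (hQfull : FullDim Q)
    (hbP : IsBipartiteWith P V1 V2 r1 r2 ℓ)
    (hbQ : IsBipartiteWith Q W1 W2 r1 r2 ℓ) :
    (∃ T : Euc 2 ≃ₗᵢ[ℝ] Euc 2, T '' P = Q) ∧
    (Set.extremePoints ℝ P).ncard = (Set.extremePoints ℝ Q).ncard := by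
  have hP' := hbP.hasBipartition
  have hQ' := hbQ.hasBipartition
  obtain ⟨φ, hφ⟩ := hP'.exists_polarPoint_mem_left hP hPfull
  obtain ⟨ψ, hψ⟩ := hQ'.exists_polarPoint_mem_left hQ hQfull
  have hvert : planeRotation (ψ - φ) '' Set.extremePoints ℝ P = Set.extremePoints ℝ Q := by
    rw [hP'.extremePoints_eq hP hPfull hφ, hQ'.extremePoints_eq hQ hQfull hψ, image_iUnion]
    refine iUnion_congr fun j => ?_
    rw [image_pair, planeRotation_polarPoint, planeRotation_polarPoint]
    congr 2 <;> ring_nf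
  refine ⟨⟨planeRotation (ψ - φ), ?_⟩, ?_⟩
  · rw [← convexHull_extremePoints_of_finite hP.isCompact hP.convex hP.finite_extremePoints,
      ← convexHull_extremePoints_of_finite hQ.isCompact hQ.convex hQ.finite_extremePoints, ← hvert]
    exact (planeRotation (ψ - φ)).toLinearEquiv.toLinearMap.image_convexHull _
  · rw [← hvert, ncard_image_of_injective _ (planeRotation (ψ - φ)).injective]
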